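/- arXiv:1010.5160 — 5 statements merged into one kernel-verified Lean document; each statement's English description precedes it below -/
import Mathlib

section
/- Let X be a finite alphabet and let Ψ = {S_j : X* → ℝ^p | j ∈ J} be an indexed family of formal power series. Suppose that for some natural number N > 0 the three ranks rank H_{Ψ,N,N}, rank H_{Ψ,N,N+1} and rank H_{Ψ,N+1,N} are all equal. Then there exists a rational representation R_N of type p–J of dimension rank H_{Ψ,N,N} which is a (2N+1)-partial representation of Ψ (that is, S_j(w) = C A_w B_j for all j ∈ J and all words w with |w| ≤ 2N+1), and R_N is reachable and observable. -/
open Matrix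

section PowerSeriesDefs

variable {X J : Type*} {p n : ℕ}

/-- `A_w = A_{σ_k} ⋯ A_{σ_1}` for the word `w = σ_1 ⋯ σ_k`. -/
def wordProd {n : ℕ} (A : X → Matrix (Fin n) (Fin n) ℝ) : List X → Matrix (Fin n) (Fin n) ℝ
  | [] => 1
  | σ :: w => wordProd A w * A σ

/-- Column of the full Hankel matrix of the family `S`, indexed by `(w, j)`. -/
def hankelCol (S : J → List X → Fin p → ℝ) (w : List X) (j : J) : List X × Fin p → ℝ :=
  fun vi => S j (w ++ vi.1) vi.2

/-- Linear span of the columns of the full Hankel matrix `H_Ψ`. -/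
def fullHankelSpan (S : J → List X → Fin p → ℝ) : Submodule ℝ (List X × Fin p → ℝ) :=
  Submodule.span ℝ (Set.range fun wj : List X × J => hankelCol S wj.1 wj.2)

/-- Column of the sub-Hankel matrix `H_{Ψ,M,K}` (rows restricted to `|v| ≤ M`). -/
def hankelColTrunc (S : J → List X → Fin p → ℝ) (M : ℕ) (w : List X) (j : J) :
    {v : List X // v.length ≤ M} × Fin p → ℝ :=
  fun vi => S j (w ++ vi.1.1) vi.2

/-- `rank H_{Ψ,M,K}` : dimension of the span of the columns of the sub-Hankel matrix
whose rows are indexed by `(v,i)` with `|v| ≤ M` and whose columns are indexed by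
`(w,j)` with `|w| ≤ K`. -/
noncomputable def hankelRank (S : J → List X → Fin p → ℝ) (M K : ℕ) : ℕ :=
  Module.finrank ℝ (Submodule.span ℝ
    (Set.range fun wj : {w : List X // w.length ≤ K} × J =>
      hankelColTrunc S M wj.1.1 wj.2))

/-- `R = (ℝⁿ, {A_σ}, B, C)` is an `N`-partial representation of the family `S`. -/
def IsPartialRep (S : J → List X → Fin p → ℝ) (N : ℕ)
    (A : X → Matrix (Fin n) (Fin n) ℝ) (B : J → Fin n → ℝ)
    (C : Matrix (Fin p) (Fin n) ℝ) : Prop :=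
  ∀ (j : J) (w : List X), w.length ≤ N → S j w = C.mulVec ((wordProd A w).mulVec (B j))

/-- `R = (ℝⁿ, {A_σ}, B, C)` is a (complete) representation of the family `S`. -/
def IsRep (S : J → List X → Fin p → ℝ)
    (A : X → Matrix (Fin n) (Fin n) ℝ) (B : J → Fin n → ℝ)
    (C : Matrix (Fin p) (Fin n) ℝ) : Prop :=
  ∀ (j : J) (w : List X), S j w = C.mulVec ((wordProd A w).mulVec (B j))

/-- Reachability: the span of the vectors `A_w B_j` is the whole state space. -/
def IsReachable (A : X → Matrix (Fin n) (Fin n) ℝ) (B : J → Fin n → ℝ) : Prop :=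
  Submodule.span ℝ
    {x : Fin n → ℝ | ∃ (w : List X) (j : J), x = (wordProd A w).mulVec (B j)} = ⊤

/-- Observability: the intersection of the kernels of the maps `C A_w` is trivial. -/
def IsObservable (A : X → Matrix (Fin n) (Fin n) ℝ)
    (C : Matrix (Fin p) (Fin n) ℝ) : Prop :=
  ∀ x : Fin n → ℝ, (∀ w : List X, C.mulVec ((wordProd A w).mulVec x) = 0) → x = 0

end PowerSeriesDefs

open Module

section HankelRealization

variable {X J : Type*} {p n : ℕ}

/-- Column space of the sub-Hankel matrix `H_{Ψ,M,K}`. -/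
def hankelSpan (S : J → List X → Fin p → ℝ) (M K : ℕ) :
    Submodule ℝ ({v : List X // v.length ≤ M} × Fin p → ℝ) :=
  Submodule.span ℝ
    (Set.range fun wj : {w : List X // w.length ≤ K} × J => hankelColTrunc S M wj.1.1 wj.2)

theorem finrank_hankelSpan (S : J → List X → Fin p → ℝ) (M K : ℕ) :
    finrank ℝ (hankelSpan S M K) = hankelRank S M K := rfl

theorem finite_words [Finite X] (M : ℕ) : Finite {v : List X // v.length ≤ M} :=
  (List.finite_length_le X M).to_subtype

theorem hankelColTrunc_mem (S : J → List X → Fin p → ℝ) (M : ℕ) {K : ℕ} {w : List X}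
    (hw : w.length ≤ K) (j : J) : hankelColTrunc S M w j ∈ hankelSpan S M K :=
  Submodule.subset_span ⟨(⟨w, hw⟩, j), rfl⟩

theorem hankelSpan_le_iff {S : J → List X → Fin p → ℝ} {M K : ℕ}
    {P : Submodule ℝ ({v : List X // v.length ≤ M} × Fin p → ℝ)} :
    hankelSpan S M K ≤ P ↔
      ∀ (w : List X) (j : J), w.length ≤ K → hankelColTrunc S M w j ∈ P := by
  rw [hankelSpan, Submodule.span_le, Set.range_subset_iff]
  exact ⟨fun h w j hw => h (⟨w, hw⟩, j), fun h wj => h _ _ wj.1.2⟩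

/-- Forget the rows indexed by words of length `M + 1`. -/
def rowRestrict (X : Type*) (p M : ℕ) :
    ({v : List X // v.length ≤ M + 1} × Fin p → ℝ) →ₗ[ℝ]
      ({v : List X // v.length ≤ M} × Fin p → ℝ) :=
  LinearMap.funLeft ℝ ℝ fun vi => (⟨vi.1.1, vi.1.2.trans (Nat.le_succ M)⟩, vi.2)

/-- Keep only the rows indexed by words starting with `σ`, and remove this letter. -/
def rowShift (p M : ℕ) (σ : X) :
    ({v : List X // v.length ≤ M + 1} × Fin p → ℝ) →ₗ[ℝ]
      ({v : List X // v.length ≤ M} × Fin p → ℝ) :=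
  LinearMap.funLeft ℝ ℝ fun vi => (⟨σ :: vi.1.1, Nat.succ_le_succ vi.1.2⟩, vi.2)

theorem rowRestrict_hankelColTrunc (S : J → List X → Fin p → ℝ) (M : ℕ) (w : List X) (j : J) :
    rowRestrict X p M (hankelColTrunc S (M + 1) w j) = hankelColTrunc S M w j := rfl

theorem rowShift_hankelColTrunc (S : J → List X → Fin p → ℝ) (M : ℕ) (σ : X) (w : List X)
    (j : J) :
    rowShift p M σ (hankelColTrunc S (M + 1) w j) = hankelColTrunc S M (w ++ [σ]) j := by
  ext vi
  simp [rowShift, LinearMap.funLeft_apply, hankelColTrunc]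

theorem map_rowRestrict_hankelSpan (S : J → List X → Fin p → ℝ) (M K : ℕ) :
    (hankelSpan S (M + 1) K).map (rowRestrict X p M) = hankelSpan S M K := by
  rw [hankelSpan, Submodule.map_span, ← Set.range_comp]
  rfl

theorem hankelSpan_eq_succ_of_hankelRank_eq [Finite X] {S : J → List X → Fin p → ℝ} {M K : ℕ}
    (h : hankelRank S M K = hankelRank S M (K + 1)) :
    hankelSpan S M K = hankelSpan S M (K + 1) := by
  have := finite_words (X := X) M
  exact Submodule.eq_of_le_of_finrank_eq
    (hankelSpan_le_iff.2 fun w j hw => hankelColTrunc_mem S M (hw.trans (Nat.le_succ K)) j) h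

/-- If adding longer rows does not increase the rank, then columns of the smaller sub-Hankel
matrix extend linearly to columns of the larger one. -/
theorem exists_extension_of_hankelRank_eq [Finite X] {S : J → List X → Fin p → ℝ} {M K : ℕ}
    (h : hankelRank S M K = hankelRank S (M + 1) K) :
    ∃ E : hankelSpan S M K ≃ₗ[ℝ] hankelSpan S (M + 1) K,
      (∀ f, rowRestrict X p M (E f) = f) ∧
      ∀ (f : hankelSpan S M K) (w : List X) (j : J), w.length ≤ K →
        f.1 = hankelColTrunc S M w j →
          (E f).1 = hankelColTrunc S (M + 1) w j := by
  have := finite_words (X := X) M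
  have := finite_words (X := X) (M + 1)
  let r : hankelSpan S (M + 1) K →ₗ[ℝ] hankelSpan S M K :=
    (rowRestrict X p M).restrict fun f hf =>
      (map_rowRestrict_hankelSpan S M K).le (Submodule.mem_map_of_mem hf)
  have hr : Function.Surjective r := by
    rintro ⟨f, hf⟩
    obtain ⟨g, hg, rfl⟩ := (map_rowRestrict_hankelSpan S M K).ge hf
    exact ⟨⟨g, hg⟩, rfl⟩
  let e := LinearEquiv.ofBijective r
    ⟨(LinearMap.injective_iff_surjective_of_finrank_eq_finrank h.symm).2 hr, hr⟩
  refine ⟨e.symm, fun f => congrArg Subtype.val (e.apply_symm_apply f), ?_⟩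
  intro f w j hw hf
  have : e.symm f = ⟨_, hankelColTrunc_mem S (M + 1) hw j⟩ := by
    rw [LinearEquiv.symm_apply_eq]
    exact Subtype.ext hf
  rw [this]

/-- The shift maps on the column space of a sub-Hankel matrix of stable rank. -/
theorem exists_shift_hankelSpan [Finite X] {S : J → List X → Fin p → ℝ} {N : ℕ}
    (h1 : hankelRank S N N = hankelRank S N (N + 1))
    (h2 : hankelRank S N N = hankelRank S (N + 1) N) :
    ∃ A : X → hankelSpan S N N →ₗ[ℝ] hankelSpan S N N,
      (∀ (σ : X) (f : hankelSpan S N N) (w : List X) (j : J), w.length ≤ N →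
        f.1 = hankelColTrunc S N w j →
          (A σ f).1 = hankelColTrunc S N (w ++ [σ]) j) ∧
      ∀ (σ : X) (f : hankelSpan S N N) (v : List X) (i : Fin p) (h : (σ :: v).length ≤ N),
        (A σ f).1 (⟨v, (Nat.le_succ _).trans h⟩, i) = f.1 (⟨σ :: v, h⟩, i) := by
  obtain ⟨E, hE, hcol⟩ := exists_extension_of_hankelRank_eq h2
  have hshift (σ : X) : ∀ f ∈ hankelSpan S (N + 1) N, rowShift p N σ f ∈ hankelSpan S N N := by
    rw [hankelSpan_eq_succ_of_hankelRank_eq h1]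
    refine hankelSpan_le_iff (P := (hankelSpan S N (N + 1)).comap (rowShift p N σ)) |>.2 ?_
    intro w j hw
    rw [Submodule.mem_comap, rowShift_hankelColTrunc]
    exact hankelColTrunc_mem S N (by simpa using hw) j
  refine ⟨fun σ => (rowShift p N σ).restrict (hshift σ) ∘ₗ E.toLinearMap, ?_, ?_⟩
  · intro σ f w j hw hf
    rw [← rowShift_hankelColTrunc, ← hcol f w j hw hf]
    rfl
  · intro σ f v i h
    conv_rhs => rw [← hE f]
    rfl

/-- A word acts on `x` by applying the maps `A_σ` of its letters from first to last. -/
def wordAct {V : Type*} (A : X → V → V) (w : List X) (x : V) : V :=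
  w.foldl (fun y σ => A σ y) x

theorem wordProd_mulVec_of_semiconj {V : Type*} {A' : X → V → V} {e : V → Fin n → ℝ}
    {A : X → Matrix (Fin n) (Fin n) ℝ} (h : ∀ σ x, (A σ).mulVec (e x) = e (A' σ x))
    (w : List X) (x : V) : (wordProd A w).mulVec (e x) = e (wordAct A' w x) := by
  induction w generalizing x with
  | nil => simp [wordProd, wordAct]
  | cons σ w ih =>
    rw [wordProd, ← Matrix.mulVec_mulVec, h, ih]
    rfl

end HankelRealization

/-- if `rank H_{Ψ,N,N} = rank H_{Ψ,N,N+1} = rank H_{Ψ,N+1,N}` for some `N > 0`,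
then there is a reachable and observable `(2N+1)`-partial representation of `Ψ` of
dimension `rank H_{Ψ,N,N}`. -/
theorem stmt0 {X J : Type*} [Fintype X] {p : ℕ} (S : J → List X → Fin p → ℝ)
    (N : ℕ) (hN : 0 < N)
    (h1 : hankelRank S N N = hankelRank S N (N + 1))
    (h2 : hankelRank S N N = hankelRank S (N + 1) N) :
    ∃ (A : X → Matrix (Fin (hankelRank S N N)) (Fin (hankelRank S N N)) ℝ)
      (B : J → Fin (hankelRank S N N) → ℝ)
      (C : Matrix (Fin p) (Fin (hankelRank S N N)) ℝ),
      IsPartialRep S (2 * N + 1) A B C ∧ IsReachable A B ∧ IsObservable A C := by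
  obtain ⟨A, hcol, hrow⟩ := exists_shift_hankelSpan h1 h2
  have := finite_words (X := X) N
  let e : hankelSpan S N N ≃ₗ[ℝ] (Fin (hankelRank S N N) → ℝ) :=
    (finBasisOfFinrankEq ℝ _ (finrank_hankelSpan S N N)).equivFun
  let b (j : J) : hankelSpan S N N := ⟨hankelColTrunc S N [] j, hankelColTrunc_mem S N (by simp) j⟩
  let c : hankelSpan S N N →ₗ[ℝ] (Fin p → ℝ) :=
    LinearMap.funLeft ℝ ℝ (fun i => (⟨[], by simp⟩, i)) ∘ₗ (hankelSpan S N N).subtype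
  let act : List X → hankelSpan S N N → hankelSpan S N N := wordAct fun σ f => A σ f
  have hreach (j : J) (w : List X) (hw : w.length ≤ N + 1) :
      (act w (b j)).1 = hankelColTrunc S N w j := by
    induction w using List.reverseRecOn with
    | nil => rfl
    | append_singleton w σ ih =>
      have hw' : w.length ≤ N := by simpa using hw
      have := hcol σ _ w j hw' (ih (by omega))
      simpa [act, wordAct] using this
  have hobs (v : List X) (hv : v.length ≤ N) (f : hankelSpan S N N) (i : Fin p) :
      c (act v f) i = f.1 (⟨v, hv⟩, i) := by
    induction v generalizing f with
    | nil => rfl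
    | cons σ v ih =>
      rw [← hrow σ f v i hv]
      exact ih _ (A σ f)
  have hprod := wordProd_mulVec_of_semiconj (A' := fun σ f => A σ f) (e := e)
    (A := fun σ => LinearMap.toMatrix' (e.toLinearMap ∘ₗ A σ ∘ₗ e.symm.toLinearMap))
    (fun σ f => by simp [LinearMap.toMatrix'_mulVec])
  have hout (f : hankelSpan S N N) :
      (LinearMap.toMatrix' (c ∘ₗ e.symm.toLinearMap)).mulVec (e f) = c f := by
    simp [LinearMap.toMatrix'_mulVec]
  refine ⟨fun σ => LinearMap.toMatrix' (e.toLinearMap ∘ₗ A σ ∘ₗ e.symm.toLinearMap),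
    fun j => e (b j), LinearMap.toMatrix' (c ∘ₗ e.symm.toLinearMap), ?_, ?_, ?_⟩
  · intro j w hw
    rw [hprod, hout]
    ext i
    have hsplit : wordAct (fun σ f => A σ f) w (b j) =
        act (w.drop (N + 1)) (act (w.take (N + 1)) (b j)) := by
      simp only [act, wordAct]
      rw [← List.foldl_append, List.take_append_drop]
    rw [hsplit, hobs _ (by rw [List.length_drop]; omega),
      hreach _ _ (by simp)]
    simp [hankelColTrunc]
  · rw [IsReachable, eq_top_iff, ← LinearEquiv.range e, LinearMap.range_eq_map,
      Submodule.map_le_iff_le_comap]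
    rintro ⟨f, hf⟩ -
    have hle : hankelSpan S N N ≤
        ((Submodule.span ℝ {x | ∃ w j, x = (wordProd (fun σ => LinearMap.toMatrix'
          (e.toLinearMap ∘ₗ A σ ∘ₗ e.symm.toLinearMap)) w).mulVec (e (b j))}).comap
            e.toLinearMap).map (hankelSpan S N N).subtype :=
      hankelSpan_le_iff.2 fun w j hw => ⟨act w (b j),
        Submodule.subset_span ⟨w, j, (hprod w (b j)).symm⟩, hreach j w (by omega)⟩
    obtain ⟨g, hg, rfl⟩ := hle hf
    exact hg
  · intro x hx
    obtain ⟨f, rfl⟩ := e.surjective x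
    simp only [hprod, hout] at hx
    have hf : f = 0 := by
      ext ⟨⟨v, hv⟩, i⟩
      rw [← hobs v hv f i]
      exact congrFun (hx v) i
    rw [hf, map_zero]
end

section
/- Let X be a finite alphabet and Ψ = {S_j : X* → ℝ^p | j ∈ J} a family of formal power series. Suppose for some N > 0 that the span of the columns of the full Hankel matrix H_Ψ is finite-dimensional with dimension equal to rank H_{Ψ,N,N}. Then rank H_{Ψ,N,N} = rank H_{Ψ,N,N+1} = rank H_{Ψ,N+1,N}, and there exists a rational representation of Ψ (valid for all words) of dimension rank H_{Ψ,N,N}; moreover every rational representation of Ψ has dimension at least rank H_{Ψ,N,N}, i.e., the constructed representation is minimal. -/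
open Matrix

/-- The word matrices turn concatenation into reversed multiplication. -/
theorem wordProd_append {X : Type*} {n : ℕ} (A : X → Matrix (Fin n) (Fin n) ℝ) (w v : List X) :
    wordProd A (w ++ v) = wordProd A v * wordProd A w := by
  induction w with
  | nil => simp [wordProd]
  | cons σ w ih => simp [wordProd, ih, Matrix.mul_assoc]

theorem hankelRank_mono_right {X J : Type*} [Finite X] {p : ℕ} (S : J → List X → Fin p → ℝ)
    (M : ℕ) {K K' : ℕ} (h : K ≤ K') : hankelRank S M K ≤ hankelRank S M K' := by
  have : Finite {v : List X // v.length ≤ M} := List.finite_length_le X M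
  refine Submodule.finrank_mono (Submodule.span_mono ?_)
  rintro _ ⟨⟨⟨w, hw⟩, j⟩, rfl⟩
  exact ⟨⟨⟨w, hw.trans h⟩, j⟩, rfl⟩

theorem hankelRank_mono_left {X J : Type*} [Finite X] {p : ℕ} (S : J → List X → Fin p → ℝ)
    {M M' : ℕ} (K : ℕ) (h : M ≤ M') : hankelRank S M K ≤ hankelRank S M' K := by
  have : Finite {v : List X // v.length ≤ M'} := List.finite_length_le X M'
  let res : ({v : List X // v.length ≤ M'} × Fin p → ℝ) →ₗ[ℝ]
      ({v : List X // v.length ≤ M} × Fin p → ℝ) :=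
    LinearMap.funLeft ℝ ℝ fun vi => (⟨vi.1.1, vi.1.2.trans h⟩, vi.2)
  have hmap := Submodule.finrank_map_le res (Submodule.span ℝ
    (Set.range fun wj : {w : List X // w.length ≤ K} × J => hankelColTrunc S M' wj.1.1 wj.2))
  rw [Submodule.map_span, ← Set.range_comp] at hmap
  exact hmap

theorem hankelRank_le_finrank_fullHankelSpan {X J : Type*} {p : ℕ} (S : J → List X → Fin p → ℝ)
    [Module.Finite ℝ (fullHankelSpan S)] (M K : ℕ) :
    hankelRank S M K ≤ Module.finrank ℝ (fullHankelSpan S) := by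
  let res : (List X × Fin p → ℝ) →ₗ[ℝ] ({v : List X // v.length ≤ M} × Fin p → ℝ) :=
    LinearMap.funLeft ℝ ℝ fun vi => (vi.1.1, vi.2)
  refine (Submodule.finrank_mono (t := (fullHankelSpan S).map res) ?_).trans
    (Submodule.finrank_map_le res _)
  rw [Submodule.span_le]
  rintro _ ⟨⟨⟨w, hw⟩, j⟩, rfl⟩
  exact ⟨hankelCol S w j, Submodule.subset_span ⟨(w, j), rfl⟩, rfl⟩

/-- Left shift by the letter `σ`. -/
def wordShift {X : Type*} (p : ℕ) (σ : X) :
    (List X × Fin p → ℝ) →ₗ[ℝ] (List X × Fin p → ℝ) :=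
  LinearMap.funLeft ℝ ℝ fun vi => (σ :: vi.1, vi.2)

theorem wordShift_mem_fullHankelSpan {X J : Type*} {p : ℕ} (S : J → List X → Fin p → ℝ) (σ : X) :
    ∀ f ∈ fullHankelSpan S, wordShift p σ f ∈ fullHankelSpan S := by
  suffices h : fullHankelSpan S ≤ (fullHankelSpan S).comap (wordShift p σ) from h
  refine Submodule.span_le.2 ?_
  rintro _ ⟨⟨w, j⟩, rfl⟩
  refine Submodule.subset_span ⟨(w ++ [σ], j), ?_⟩
  ext vi
  simp [hankelCol, wordShift, LinearMap.funLeft_apply]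

/-- The shift representation on the column space of the Hankel matrix. -/
theorem exists_isRep_of_finrank_fullHankelSpan {X J : Type*} {p : ℕ}
    (S : J → List X → Fin p → ℝ) [Module.Finite ℝ (fullHankelSpan S)] {r : ℕ}
    (hr : Module.finrank ℝ (fullHankelSpan S) = r) :
    ∃ (A : X → Matrix (Fin r) (Fin r) ℝ) (B : J → Fin r → ℝ) (C : Matrix (Fin p) (Fin r) ℝ),
      IsRep S A B C := by
  let b := Module.finBasisOfFinrankEq ℝ (fullHankelSpan S) hr
  let T : X → fullHankelSpan S →ₗ[ℝ] fullHankelSpan S := fun σ =>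
    (wordShift p σ).restrict (wordShift_mem_fullHankelSpan S σ)
  let E : fullHankelSpan S →ₗ[ℝ] (Fin p → ℝ) :=
    LinearMap.funLeft ℝ ℝ (fun i => (([] : List X), i)) ∘ₗ (fullHankelSpan S).subtype
  let A := fun σ => LinearMap.toMatrix b b (T σ)
  let C := LinearMap.toMatrix b (Pi.basisFun ℝ (Fin p)) E
  have key : ∀ (w : List X) (f : fullHankelSpan S),
      C.mulVec ((wordProd A w).mulVec (b.repr f)) = fun i => f.1 (w, i) := by
    intro w
    induction w with
    | nil =>
      intro f
      rw [wordProd, Matrix.one_mulVec, LinearMap.toMatrix_mulVec_repr]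
      rfl
    | cons σ w ih =>
      intro f
      rw [wordProd, ← Matrix.mulVec_mulVec, LinearMap.toMatrix_mulVec_repr, ih]
      rfl
  refine ⟨A, fun j => b.repr ⟨hankelCol S [] j, Submodule.subset_span ⟨([], j), rfl⟩⟩, C,
    fun j w => ?_⟩
  rw [key]
  rfl

theorem IsRep.finrank_fullHankelSpan_le {X J : Type*} {p n : ℕ} {S : J → List X → Fin p → ℝ}
    {A : X → Matrix (Fin n) (Fin n) ℝ} {B : J → Fin n → ℝ} {C : Matrix (Fin p) (Fin n) ℝ}
    (h : IsRep S A B C) : Module.finrank ℝ (fullHankelSpan S) ≤ n := by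
  let O : (Fin n → ℝ) →ₗ[ℝ] (List X × Fin p → ℝ) :=
    LinearMap.pi fun vi => LinearMap.proj vi.2 ∘ₗ (C * wordProd A vi.1).mulVecLin
  have hO : fullHankelSpan S ≤ LinearMap.range O := by
    refine Submodule.span_le.2 ?_
    rintro _ ⟨⟨w, j⟩, rfl⟩
    refine ⟨(wordProd A w).mulVec (B j), ?_⟩
    ext ⟨v, i⟩
    simp [O, hankelCol, h j (w ++ v), wordProd_append, Matrix.mulVec_mulVec]
  calc Module.finrank ℝ (fullHankelSpan S) ≤ Module.finrank ℝ (LinearMap.range O) :=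
        Submodule.finrank_mono hO
    _ ≤ Module.finrank ℝ (Fin n → ℝ) := LinearMap.finrank_range_le O
    _ = n := Module.finrank_fin_fun ℝ

/-- if the span of the columns of the full Hankel matrix is
finite-dimensional of dimension `rank H_{Ψ,N,N}` for some `N > 0`, then the three
finite rank conditions hold, there is a (complete) representation of `Ψ` of dimension
`rank H_{Ψ,N,N}`, and every representation of `Ψ` has dimension at least
`rank H_{Ψ,N,N}` (so the constructed one is minimal). -/
theorem stmt1 {X J : Type*} [Fintype X] {p : ℕ} (S : J → List X → Fin p → ℝ)
    (N : ℕ) (hN : 0 < N)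
    (hfull : Module.rank ℝ (fullHankelSpan S) = (hankelRank S N N : Cardinal)) :
    (hankelRank S N N = hankelRank S N (N + 1) ∧
      hankelRank S N N = hankelRank S (N + 1) N) ∧
    (∃ (A : X → Matrix (Fin (hankelRank S N N)) (Fin (hankelRank S N N)) ℝ)
       (B : J → Fin (hankelRank S N N) → ℝ)
       (C : Matrix (Fin p) (Fin (hankelRank S N N)) ℝ), IsRep S A B C) ∧
    (∀ (n : ℕ) (A : X → Matrix (Fin n) (Fin n) ℝ) (B : J → Fin n → ℝ)
       (C : Matrix (Fin p) (Fin n) ℝ), IsRep S A B C → hankelRank S N N ≤ n) := by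
  have hr : Module.finrank ℝ (fullHankelSpan S) = hankelRank S N N :=
    Module.finrank_eq_of_rank_eq hfull
  have : Module.Finite ℝ (fullHankelSpan S) := by
    rw [← Module.rank_lt_aleph0_iff, hfull]
    exact Cardinal.natCast_lt_aleph0
  refine ⟨⟨?_, ?_⟩, exists_isRep_of_finrank_fullHankelSpan S hr,
    fun n A B C h => hr ▸ h.finrank_fullHankelSpan_le⟩
  · exact (hankelRank_mono_right S N N.le_succ).antisymm
      (hr ▸ hankelRank_le_finrank_fullHankelSpan S N (N + 1))
  · exact (hankelRank_mono_left S N N.le_succ).antisymm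
      (hr ▸ hankelRank_le_finrank_fullHankelSpan S (N + 1) N)
end

section
/- Let X be a finite alphabet, Ψ = {S_j : X* → ℝ^p | j ∈ J} a family of formal power series, N > 0, and suppose rank H_{Ψ,N,N} = rank H_{Ψ,N,N+1} = rank H_{Ψ,N+1,N} = r. Let O be a matrix with rows indexed by pairs (v,i), |v| ≤ N+1, i ∈ {1,…,p}, and columns {1,…,r}, and let R be a matrix with rows {1,…,r} and columns indexed by pairs (w,j), |w| ≤ N, j ∈ J, such that H_{Ψ,N+1,N} = O·R and rank O = rank R = r. Define C̃ ∈ ℝ^{p×r} whose i-th row is the row of O indexed by (ε,i); for j ∈ J let B̃_j ∈ ℝ^r be the column of R indexed by (ε,j); and for σ ∈ X define matrices Γ̄ and Γ̄_σ, with rows indexed by pairs (u,i), |u| ≤ N, i ∈ {1,…,p}, and columns {1,…,r}, by letting the row of Γ̄ indexed by (u,i) be the row of O indexed by (u,i) and the row of Γ̄_σ indexed by (u,i) be the row of O indexed by (σu,i). Then for each σ ∈ X there exists a unique matrix Ã_σ ∈ ℝ^{r×r} with Γ̄ Ã_σ = Γ̄_σ, and the representation R̃_N = (ℝ^r, {Ã_σ}_{σ∈X},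 {B̃_j}_{j∈J}, C̃) is a (2N+1)-partial representation of Ψ which is reachable and observable, and hence a minimal (2N+1)-partial representation of Ψ. -/
open Matrix

/-- Rank of a (possibly infinite) matrix `M : I → K → ℝ` (rows `I`, columns `K`):
the dimension of the span of its columns. -/
noncomputable def colRank {I K : Type*} (M : I → K → ℝ) : ℕ :=
  Module.finrank ℝ (Submodule.span ℝ (Set.range fun k : K => fun i : I => M i k))

theorem finite_words_length_le (X : Type*) [Finite X] (M : ℕ) :
    Finite {v : List X // v.length ≤ M} :=
  (List.finite_length_le X M).to_subtype

theorem span_columns_eq_top {K : Type*} {r : ℕ} {R : Fin r → K → ℝ} (hR : colRank R = r) :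
    Submodule.span ℝ (Set.range fun k : K => fun i : Fin r => R i k) = ⊤ :=
  Submodule.eq_top_of_finrank_eq (by simpa [colRank] using hR)

/-- A linear map sending a spanning family to a family whose span has the dimension of the domain
is injective. -/
theorem injective_of_finrank_span_image {V W K : Type*} [AddCommGroup V] [Module ℝ V]
    [FiniteDimensional ℝ V] [AddCommGroup W] [Module ℝ W] (f : V →ₗ[ℝ] W) (b : K → V)
    (hb : Submodule.span ℝ (Set.range b) = ⊤)
    (hf : Module.finrank ℝ (Submodule.span ℝ (Set.range fun k => f (b k))) =
      Module.finrank ℝ V) :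
    Function.Injective f := by
  have hrange : Submodule.span ℝ (Set.range fun k => f (b k)) = LinearMap.range f := by
    rw [LinearMap.range_eq_map, ← hb, Submodule.map_span, ← Set.range_comp]
    rfl
  rw [hrange] at hf
  have hsum := f.finrank_range_add_finrank_ker
  exact LinearMap.ker_eq_bot.mp (Submodule.finrank_eq_zero.mp (by omega))

theorem span_hankelColTrunc_eq {X J : Type*} [Finite X] {p : ℕ} {S : J → List X → Fin p → ℝ}
    {M K L : ℕ} (hKL : K ≤ L) (h : hankelRank S M K = hankelRank S M L) :
    Submodule.span ℝ (Set.range fun wj : {w : List X // w.length ≤ K} × J =>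
      hankelColTrunc S M wj.1.1 wj.2) =
    Submodule.span ℝ (Set.range fun wj : {w : List X // w.length ≤ L} × J =>
      hankelColTrunc S M wj.1.1 wj.2) := by
  have := finite_words_length_le X M
  refine Submodule.eq_of_le_of_finrank_eq (Submodule.span_mono ?_) h
  rintro _ ⟨⟨⟨w, hw⟩, j⟩, rfl⟩
  exact ⟨(⟨w, hw.trans hKL⟩, j), rfl⟩

/-- The dimension of an `(M + K)`-partial representation bounds the rank of `H_{Ψ,M,K}`. -/
theorem IsPartialRep.hankelRank_le {X J : Type*} {p n : ℕ} {S : J → List X → Fin p → ℝ}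
    {L M K : ℕ} {A : X → Matrix (Fin n) (Fin n) ℝ} {B : J → Fin n → ℝ}
    {C : Matrix (Fin p) (Fin n) ℝ} (h : IsPartialRep S L A B C) (hL : K + M ≤ L) :
    hankelRank S M K ≤ n := by
  let f : (Fin n → ℝ) →ₗ[ℝ] ({v : List X // v.length ≤ M} × Fin p → ℝ) :=
    LinearMap.pi fun vi => LinearMap.proj vi.2 ∘ₗ (C * wordProd A vi.1.1).mulVecLin
  have hle : Submodule.span ℝ (Set.range fun wj : {w : List X // w.length ≤ K} × J =>
      hankelColTrunc S M wj.1.1 wj.2) ≤ LinearMap.range f := by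
    rw [Submodule.span_le]
    rintro _ ⟨⟨⟨w, hw⟩, j⟩, rfl⟩
    refine ⟨(wordProd A w).mulVec (B j), ?_⟩
    funext ⟨⟨v, hv⟩, i⟩
    have hS := h j (w ++ v) (by rw [List.length_append]; omega)
    simp [f, hankelColTrunc, hS, wordProd_append, Matrix.mulVec_mulVec]
  calc hankelRank S M K ≤ Module.finrank ℝ (LinearMap.range f) := Submodule.finrank_mono hle
    _ ≤ Module.finrank ℝ (Fin n → ℝ) := LinearMap.finrank_range_le f
    _ = n := Module.finrank_fin_fun ℝ

/-- The equation `G * A = G'` is uniquely solvable when `G` has independent columns and `G'`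
maps a spanning family into the range of `G`. -/
theorem existsUnique_mul_eq {I K : Type*} {r : ℕ} (G G' : Matrix I (Fin r) ℝ)
    (hG : Function.Injective G.mulVecLin) (b : K → Fin r → ℝ)
    (hb : Submodule.span ℝ (Set.range b) = ⊤)
    (hrange : ∀ k, G'.mulVecLin (b k) ∈ LinearMap.range G.mulVecLin) :
    ∃! A : Matrix (Fin r) (Fin r) ℝ, G * A = G' := by
  have hle : ∀ x, G'.mulVecLin x ∈ LinearMap.range G.mulVecLin := by
    have : (⊤ : Submodule ℝ (Fin r → ℝ)) ≤
        (LinearMap.range G.mulVecLin).comap G'.mulVecLin := by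
      rw [← hb, Submodule.span_le]
      rintro _ ⟨k, rfl⟩
      exact hrange k
    exact fun x => this trivial
  choose a ha using fun k => hle (Pi.single k 1)
  refine ⟨(Matrix.of a)ᵀ, ?_, fun A hA => ?_⟩
  · ext i k
    have hik := congrFun (ha k) i
    rw [Matrix.mulVecLin_apply, Matrix.mulVecLin_apply, Matrix.mulVec_single_one] at hik
    exact hik
  · ext i k
    have : A.col k = a k := hG <| by
      rw [ha, ← hA]
      simp
    exact congrFun this i

/-- the factorization-based (Kalman-Ho-like) construction. Given a rank-`r`
factorization `H_{Ψ,N+1,N} = O · R`, the matrices `Ã_σ` are the unique solutions of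
`Γ̄ Ã_σ = Γ̄_σ`, and `(ℝʳ, {Ã_σ}, {B̃_j}, C̃)` is a reachable and observable minimal
`(2N+1)`-partial representation of `Ψ`. -/
theorem stmt5 {X J : Type*} [Fintype X] {p : ℕ} (S : J → List X → Fin p → ℝ)
    (N r : ℕ) (hN : 0 < N)
    (h1 : hankelRank S N N = r) (h2 : hankelRank S N (N + 1) = r)
    (h3 : hankelRank S (N + 1) N = r)
    (O : {v : List X // v.length ≤ N + 1} × Fin p → Fin r → ℝ)
    (R : Fin r → {w : List X // w.length ≤ N} × J → ℝ)
    (hfact : ∀ (vi : {v : List X // v.length ≤ N + 1} × Fin p)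
      (wj : {w : List X // w.length ≤ N} × J),
      (∑ k : Fin r, O vi k * R k wj) = S wj.2 (wj.1.1 ++ vi.1.1) vi.2)
    (hO : colRank O = r) (hR : colRank R = r) :
    -- the data of the construction
    letI Ctil : Matrix (Fin p) (Fin r) ℝ :=
      Matrix.of fun i k => O (⟨[], Nat.zero_le _⟩, i) k
    letI Btil : J → Fin r → ℝ := fun j k => R k (⟨[], Nat.zero_le _⟩, j)
    letI Γ : {u : List X // u.length ≤ N} × Fin p → Fin r → ℝ :=
      fun ui k => O (⟨ui.1.1, ui.1.2.trans (Nat.le_succ N)⟩, ui.2) k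
    letI Γσ : X → {u : List X // u.length ≤ N} × Fin p → Fin r → ℝ :=
      fun σ ui k => O (⟨σ :: ui.1.1, Nat.succ_le_succ ui.1.2⟩, ui.2) k
    -- unique solvability of `Γ̄ Ã_σ = Γ̄_σ`
    (∀ σ : X, ∃! Atil : Matrix (Fin r) (Fin r) ℝ,
      ∀ (ui : {u : List X // u.length ≤ N} × Fin p) (k' : Fin r),
        (∑ k : Fin r, Γ ui k * Atil k k') = Γσ σ ui k') ∧
    -- and the solutions yield a minimal `(2N+1)`-partial representation
    (∀ Atil : X → Matrix (Fin r) (Fin r) ℝ,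
      (∀ (σ : X) (ui : {u : List X // u.length ≤ N} × Fin p) (k' : Fin r),
        (∑ k : Fin r, Γ ui k * Atil σ k k') = Γσ σ ui k') →
      IsPartialRep S (2 * N + 1) Atil Btil Ctil ∧
      IsReachable Atil Btil ∧ IsObservable Atil Ctil ∧
      (∀ (n : ℕ) (A' : X → Matrix (Fin n) (Fin n) ℝ) (B' : J → Fin n → ℝ)
         (C' : Matrix (Fin p) (Fin n) ℝ),
         IsPartialRep S (2 * N + 1) A' B' C' → r ≤ n)) := by
  set Γ : Matrix ({u : List X // u.length ≤ N} × Fin p) (Fin r) ℝ :=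
    fun ui k => O (⟨ui.1.1, ui.1.2.trans (Nat.le_succ N)⟩, ui.2) k
  set Γσ : X → Matrix ({u : List X // u.length ≤ N} × Fin p) (Fin r) ℝ :=
    fun σ ui k => O (⟨σ :: ui.1.1, Nat.succ_le_succ ui.1.2⟩, ui.2) k
  set b : {w : List X // w.length ≤ N} × J → Fin r → ℝ := fun wj k => R k wj
  have hb : Submodule.span ℝ (Set.range b) = ⊤ := span_columns_eq_top hR
  have hΓb : ∀ wj, Γ.mulVecLin (b wj) = hankelColTrunc S N wj.1.1 wj.2 :=
    fun wj => funext fun ui => hfact (⟨ui.1.1, ui.1.2.trans (Nat.le_succ N)⟩, ui.2) wj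
  have hΓσb : ∀ σ wj,
      (Γσ σ).mulVecLin (b wj) = hankelColTrunc S N (wj.1.1 ++ [σ]) wj.2 := by
    intro σ wj
    funext ui
    refine (hfact (⟨σ :: ui.1.1, Nat.succ_le_succ ui.1.2⟩, ui.2) wj).trans ?_
    simp [hankelColTrunc]
  have hinj : Function.Injective Γ.mulVecLin := by
    refine injective_of_finrank_span_image _ b hb ?_
    rw [Module.finrank_fin_fun, funext hΓb]
    exact h1
  have hspan := span_hankelColTrunc_eq (S := S) (Nat.le_succ N) (h1.trans h2.symm)
  have hrange : ∀ σ wj, (Γσ σ).mulVecLin (b wj) ∈ LinearMap.range Γ.mulVecLin := by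
    intro σ wj
    have hmem : hankelColTrunc S N (wj.1.1 ++ [σ]) wj.2 ∈
        Submodule.span ℝ (Set.range fun wj : {w : List X // w.length ≤ N} × J =>
          hankelColTrunc S N wj.1.1 wj.2) := by
      rw [hspan]
      exact Submodule.subset_span
        ⟨(⟨wj.1.1 ++ [σ], by simpa using wj.1.2⟩, wj.2), rfl⟩
    rw [hΓσb]
    refine Submodule.span_le.mpr ?_ hmem
    rintro _ ⟨wj, rfl⟩
    exact ⟨b wj, hΓb wj⟩
  have hentry : ∀ (σ : X) (A : Matrix (Fin r) (Fin r) ℝ), Γ * A = Γσ σ ↔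
      ∀ (ui : {u : List X // u.length ≤ N} × Fin p) (k' : Fin r),
        (∑ k : Fin r, Γ ui k * A k k') = Γσ σ ui k' :=
    fun σ A => Matrix.ext_iff.symm
  refine ⟨fun σ => (existsUnique_congr (hentry σ)).mp
    (existsUnique_mul_eq Γ (Γσ σ) hinj b hb (hrange σ)), fun A hA => ?_⟩
  have hmul : ∀ σ, Γ * A σ = Γσ σ := fun σ => (hentry σ (A σ)).mpr (hA σ)
  set C : Matrix (Fin p) (Fin r) ℝ :=
    Matrix.of fun i k => O (⟨[], Nat.zero_le _⟩, i) k with hCdef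
  have hobs : ∀ (v : List X) (hv : v.length ≤ N + 1) (i : Fin p) (k : Fin r),
      (C * wordProd A v) i k = O (⟨v, hv⟩, i) k := by
    intro v
    induction v with
    | nil => intro hv i k; simp [wordProd, hCdef]
    | cons σ u ih =>
      intro hv i k
      have hu : u.length ≤ N := Nat.le_of_succ_le_succ hv
      rw [wordProd, ← Matrix.mul_assoc, Matrix.mul_apply]
      simp_rw [ih (hu.trans (Nat.le_succ N))]
      exact hA σ (⟨u, hu⟩, i) k
  have hreach : ∀ (w : List X) (hw : w.length ≤ N) (j : J),
      (wordProd A w).mulVec (b (⟨[], Nat.zero_le _⟩, j)) = b (⟨w, hw⟩, j) := by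
    intro w
    induction w using List.reverseRecOn with
    | nil => intro hw j; simp [wordProd]
    | append_singleton w σ ih =>
      intro hw j
      have hw' : w.length ≤ N := by
        rw [List.length_append] at hw
        omega
      apply hinj
      rw [wordProd_append, ← Matrix.mulVec_mulVec, ih hw', hΓb, Matrix.mulVecLin_apply]
      have hσ := hΓσb σ (⟨w, hw'⟩, j)
      rw [← hmul, Matrix.mulVecLin_apply, ← Matrix.mulVec_mulVec] at hσ
      simpa [wordProd] using hσ
  refine ⟨fun j w hw => ?_, ?_, fun x hx => ?_, fun n A' B' C' h => ?_⟩
  · have hwN : (w.take N).length ≤ N := List.length_take_le N w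
    have hvN : (w.drop N).length ≤ N + 1 := by
      rw [List.length_drop]
      omega
    funext i
    have hS := hfact (⟨w.drop N, hvN⟩, i) (⟨w.take N, hwN⟩, j)
    rw [List.take_append_drop] at hS
    rw [← hS]
    conv_rhs => rw [← List.take_append_drop N w]
    rw [wordProd_append, ← Matrix.mulVec_mulVec]
    refine Eq.trans ?_ (congrFun (congrArg
      (fun y => C.mulVec ((wordProd A (w.drop N)).mulVec y)) (hreach _ hwN j).symm) i)
    simp only [Matrix.mulVec_mulVec]
    exact Finset.sum_congr rfl fun k _ =>
      congrArg (· * R k (⟨w.take N, hwN⟩, j)) (hobs _ hvN i k).symm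
  · rw [IsReachable, eq_top_iff, ← hb]
    refine Submodule.span_mono ?_
    rintro _ ⟨⟨⟨w, hw⟩, j⟩, rfl⟩
    exact ⟨w, j, (hreach w hw j).symm⟩
  · apply hinj
    rw [map_zero]
    funext ⟨⟨u, hu⟩, i⟩
    have hu0 := congrFun (hx u) i
    rw [Matrix.mulVec_mulVec] at hu0
    have hrow : ∀ k, Γ (⟨u, hu⟩, i) k = (C * wordProd A u) i k :=
      fun k => (hobs u (hu.trans (Nat.le_succ N)) i k).symm
    have hdot : Γ (⟨u, hu⟩, i) ⬝ᵥ x = (C * wordProd A u) i ⬝ᵥ x :=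
      congrArg (· ⬝ᵥ x) (funext hrow)
    exact hdot.trans hu0
  · exact h1 ▸ h.hankelRank_le (by omega)
end

section
/- Let X be a finite alphabet and Ψ = {S_j : X* → ℝ^p | j ∈ J} a family of formal power series. For every σ ∈ X the left shift T ↦ σ∘T maps W_Ψ into itself. If W_Ψ is finite-dimensional of dimension d, then Ψ admits a rational representation of dimension d: taking A_σ to be the restricted shift operators on W_Ψ, B_j = S_j ∈ W_Ψ, and C : W_Ψ → ℝ^p the evaluation C(T) = T(ε), one has S_j(w) = C(A_w B_j) for all j ∈ J and all w ∈ X*. -/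
section ShiftDefs

variable {X J : Type*} {p : ℕ}

/-- Left shift of a formal power series by the word `w` : `(w ∘ S)(v) = S(wv)`. -/
def wshift (w : List X) (T : List X → Fin p → ℝ) : List X → Fin p → ℝ :=
  fun v => T (w ++ v)

/-- `W_Ψ`: the smallest shift-invariant subspace containing the family `S`, i.e. the
linear span of all shifts `w ∘ S_j`. -/
def WPsi (S : J → List X → Fin p → ℝ) : Submodule ℝ (List X → Fin p → ℝ) :=
  Submodule.span ℝ (Set.range fun wj : List X × J => wshift wj.1 (S wj.2))

/-- `A_w = A_{σ_k} ∘ ⋯ ∘ A_{σ_1}` for a word `w = σ_1 ⋯ σ_k` and linear maps `A_σ`. -/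
def listComp {M : Type*} [AddCommMonoid M] [Module ℝ M]
    (A : X → M →ₗ[ℝ] M) : List X → M →ₗ[ℝ] M
  | [] => LinearMap.id
  | σ :: w => (listComp A w).comp (A σ)

end ShiftDefs

/-- The left shift by the word `w` as a linear map on formal power series. -/
def wshiftLinear {X : Type*} {p : ℕ} (w : List X) :
    (List X → Fin p → ℝ) →ₗ[ℝ] (List X → Fin p → ℝ) where
  toFun := wshift w
  map_add' _ _ := rfl
  map_smul' _ _ := rfl

theorem wshift_wshift {X : Type*} {p : ℕ} (u w : List X) (T : List X → Fin p → ℝ) :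
    wshift u (wshift w T) = wshift (w ++ u) T := by
  funext v
  simp [wshift]

theorem wshift_mem_WPsi {X J : Type*} {p : ℕ} (S : J → List X → Fin p → ℝ) (w : List X)
    {T : List X → Fin p → ℝ} (hT : T ∈ WPsi S) : wshift w T ∈ WPsi S := by
  suffices h : WPsi S ≤ (WPsi S).comap (wshiftLinear w) from h hT
  refine Submodule.span_le.2 ?_
  rintro _ ⟨⟨u, j⟩, rfl⟩
  exact Submodule.subset_span ⟨(u ++ w, j), (wshift_wshift w u (S j)).symm⟩

theorem self_mem_WPsi {X J : Type*} {p : ℕ} (S : J → List X → Fin p → ℝ) (j : J) :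
    S j ∈ WPsi S :=
  Submodule.subset_span ⟨([], j), rfl⟩

/-- Iterating the letter shifts along a word gives the shift by that word. -/
theorem coe_listComp_eq_wshift {X : Type*} {p : ℕ} {W : Submodule ℝ (List X → Fin p → ℝ)}
    (A : X → W →ₗ[ℝ] W)
    (hA : ∀ (σ : X) (T : W), (A σ T : List X → Fin p → ℝ) = wshift [σ] T) (w : List X) (T : W) :
    (listComp A w T : List X → Fin p → ℝ) = wshift w T := by
  induction w generalizing T with
  | nil => rfl
  | cons σ w ih =>
    change (listComp A w (A σ T) : List X → Fin p → ℝ) = _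
    rw [ih, hA, wshift_wshift, List.singleton_append]

/-- the left shifts map `W_Ψ` into itself, and if `W_Ψ` is
finite-dimensional of dimension `d` then `Ψ` admits a rational representation of
dimension `d` on `W_Ψ`: the state-transition maps are the restricted shifts,
`B_j = S_j`, and the readout map is evaluation at the empty word. -/
theorem stmt8 {X J : Type*} [Fintype X] {p : ℕ} (S : J → List X → Fin p → ℝ) (d : ℕ) :
    (∀ σ : X, ∀ T ∈ WPsi S, wshift [σ] T ∈ WPsi S) ∧
    (FiniteDimensional ℝ (WPsi S) → Module.finrank ℝ (WPsi S) = d →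
      ∃ A : X → (WPsi S →ₗ[ℝ] WPsi S),
        (∀ (σ : X) (T : WPsi S),
          ((A σ T : List X → Fin p → ℝ)) = wshift [σ] (T : List X → Fin p → ℝ)) ∧
        ∀ j : J, ∃ Bj : WPsi S, (Bj : List X → Fin p → ℝ) = S j ∧
          ∀ w : List X,
            S j w = ((listComp A w Bj : WPsi S) : List X → Fin p → ℝ) []) := by
  refine ⟨fun σ T hT => wshift_mem_WPsi S [σ] hT, fun _ _ => ?_⟩
  let A : X → (WPsi S →ₗ[ℝ] WPsi S) := fun σ =>
    (wshiftLinear [σ]).restrict fun _ hT => wshift_mem_WPsi S [σ] hT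
  have hA : ∀ (σ : X) (T : WPsi S), (A σ T : List X → Fin p → ℝ) = wshift [σ] T :=
    fun _ _ => rfl
  refine ⟨A, hA, fun j => ⟨⟨S j, self_mem_WPsi S j⟩, rfl, fun w => ?_⟩⟩
  rw [coe_listComp_eq_wshift A hA]
  simp [wshift]
end

section
/- Let X be a finite alphabet and Ψ = {S_j : X* → ℝ^p | j ∈ J} a family of formal power series. If W_Ψ is finite-dimensional with dim W_Ψ ≤ M+1, then the truncation to words of length at most M is injective on W_Ψ: for every T ∈ W_Ψ, if T(w) = 0 for all words w with |w| ≤ M, then T = 0. -/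
/-- The elements of `W` that vanish on all words of length less than `k`. -/
def vanishingBelow {X : Type*} {p : ℕ} (W : Submodule ℝ (List X → Fin p → ℝ)) (k : ℕ) :
    Submodule ℝ (List X → Fin p → ℝ) where
  carrier := {T | T ∈ W ∧ ∀ w : List X, w.length < k → T w = 0}
  add_mem' := fun ha hb =>
    ⟨W.add_mem ha.1 hb.1, fun w hw => by simp [ha.2 w hw, hb.2 w hw]⟩
  zero_mem' := ⟨W.zero_mem, fun _ _ => rfl⟩
  smul_mem' := fun c _ ha => ⟨W.smul_mem c ha.1, fun w hw => by simp [ha.2 w hw]⟩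

theorem vanishingBelow_le {X : Type*} {p : ℕ} (W : Submodule ℝ (List X → Fin p → ℝ)) (k : ℕ) :
    vanishingBelow W k ≤ W :=
  fun _ hT => hT.1

theorem vanishingBelow_succ_le {X : Type*} {p : ℕ} (W : Submodule ℝ (List X → Fin p → ℝ))
    (k : ℕ) : vanishingBelow W (k + 1) ≤ vanishingBelow W k :=
  fun _ hT => ⟨hT.1, fun w hw => hT.2 w (by omega)⟩

/-- Once the decreasing chain `vanishingBelow W` of a shift-invariant space `W` is stationary,
it is zero. -/
theorem vanishingBelow_eq_bot_of_le_succ {X : Type*} {p : ℕ}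
    {W : Submodule ℝ (List X → Fin p → ℝ)}
    (hW : ∀ w : List X, ∀ T ∈ W, wshift w T ∈ W) {k : ℕ}
    (h : vanishingBelow W k ≤ vanishingBelow W (k + 1)) : vanishingBelow W k = ⊥ := by
  have key : ∀ w : List X, ∀ T ∈ vanishingBelow W k, T w = 0 := by
    intro w
    induction w with
    | nil => exact fun T hT => (h hT).2 [] (by simp)
    | cons x v ih =>
      refine fun T hT => ih (wshift [x] T) ⟨hW [x] T hT.1, fun u hu => ?_⟩
      exact (h hT).2 (x :: u) (by simpa using hu)
  exact (Submodule.eq_bot_iff _).2 fun T hT => funext fun w => key w T hT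

theorem vanishingBelow_eq_bot_or_finrank_add_le {X : Type*} {p : ℕ}
    {W : Submodule ℝ (List X → Fin p → ℝ)} [FiniteDimensional ℝ W]
    (hW : ∀ w : List X, ∀ T ∈ W, wshift w T ∈ W) (k : ℕ) :
    vanishingBelow W k = ⊥ ∨
      Module.finrank ℝ (vanishingBelow W k) + k ≤ Module.finrank ℝ W := by
  induction k with
  | zero => exact Or.inr (Submodule.finrank_mono (vanishingBelow_le W 0))
  | succ k ih =>
    have hle := vanishingBelow_succ_le W k
    rcases ih with h | h
    · exact Or.inl (le_bot_iff.1 (h ▸ hle))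
    · by_cases hk : vanishingBelow W k ≤ vanishingBelow W (k + 1)
      · exact Or.inl (le_bot_iff.1 (vanishingBelow_eq_bot_of_le_succ hW hk ▸ hle))
      · have : FiniteDimensional ℝ (vanishingBelow W k) :=
          Submodule.finiteDimensional_of_le (vanishingBelow_le W k)
        have := Submodule.finrank_lt_finrank_of_lt (lt_of_le_not_ge hle hk)
        right
        omega

/-- if `W_Ψ` is finite-dimensional with `dim W_Ψ ≤ M+1`, then truncation
to words of length at most `M` is injective on `W_Ψ`: any `T ∈ W_Ψ` vanishing on all
words of length `≤ M` is zero. -/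
theorem stmt15 {X J : Type*} [Fintype X] {p : ℕ} (S : J → List X → Fin p → ℝ)
    (M : ℕ) (hdim : Module.rank ℝ (WPsi S) ≤ ((M : Cardinal) + 1)) :
    ∀ T ∈ WPsi S, (∀ w : List X, w.length ≤ M → T w = 0) → T = 0 := by
  intro T hT hzero
  have hrank : Module.rank ℝ (WPsi S) ≤ ((M + 1 : ℕ) : Cardinal) := by exact_mod_cast hdim
  have hfin : FiniteDimensional ℝ (WPsi S) :=
    Module.rank_lt_aleph0_iff.1 (hrank.trans_lt Cardinal.natCast_lt_aleph0)
  have hfinrank : Module.finrank ℝ (WPsi S) ≤ M + 1 := Module.finrank_le_of_rank_le hrank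
  have hbot : vanishingBelow (WPsi S) (M + 1) = ⊥ := by
    rcases vanishingBelow_eq_bot_or_finrank_add_le
      (fun w _ h => wshift_mem_WPsi S w h) (M + 1) with h | h
    · exact h
    · have : FiniteDimensional ℝ (vanishingBelow (WPsi S) (M + 1)) :=
        Submodule.finiteDimensional_of_le (vanishingBelow_le _ _)
      exact Submodule.finrank_eq_zero.1 (by omega)
  have hmem : T ∈ vanishingBelow (WPsi S) (M + 1) :=
    ⟨hT, fun w hw => hzero w (Nat.lt_succ_iff.1 hw)⟩
  rwa [hbot, Submodule.mem_bot] at hmem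
end
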